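/- Let R be a commutative ring and C=(C,Δ,ε) a coseparable R-coalgebra, i.e. there is an R-linear map ω : C ⊗_R C → C with ω∘Δ = id_C and (id_C ⊗ ω)∘(Δ ⊗ id_C) = Δ∘ω = (ω ⊗ id_C)∘(id_C ⊗ Δ). Let C* = Hom_R(C,R) be the dual convolution algebra, with product f*g = (g⊗f)∘Δ, and let Z(C*) be its center. Then Z(C*) is a direct summand of C* as a Z(C*)-module; that is, there is a Z(C*)-linear map π : C* → Z(C*) restricting to the identity on Z(C*). -/

import Mathlib

/-!
STATEMENT 19: For a coseparable coalgebra `C` over a commutative ring `R`, the center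
`Z(C*)` of the dual convolution algebra `C* = Hom_R(C, R)` (with product
`f * g = (g ⊗ f) ∘ Δ`) is a direct summand of `C*` as a `Z(C*)`-module: there is a
`Z(C*)`-linear retraction `π : C* → Z(C*)`.
-/

open TensorProduct

variable {R C : Type*} [CommRing R] [AddCommGroup C] [Module R C]

/-- The (opposite) convolution product `f * g = (g ⊗ f) ∘ Δ` on `C* = Hom_R(C, R)`. -/
noncomputable def conv [Coalgebra R C] (f g : C →ₗ[R] R) : C →ₗ[R] R :=
  (TensorProduct.lid R R).toLinearMap ∘ₗ (TensorProduct.map g f) ∘ₗ Coalgebra.comul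

/-- Membership in the center of the convolution algebra `C*`. -/
def InConvCenter [Coalgebra R C] (f : C →ₗ[R] R) : Prop :=
  ∀ g : C →ₗ[R] R, conv f g = conv g f

/-- Convolution as a bilinear map. -/
noncomputable def convLin [Coalgebra R C] : (C →ₗ[R] R) →ₗ[R] (C →ₗ[R] R) →ₗ[R] (C →ₗ[R] R) :=
  LinearMap.mk₂ R conv
    (fun f f' g => by simp [conv, TensorProduct.map_add_right, LinearMap.add_comp,
      LinearMap.comp_add])
    (fun r f g => by simp [conv, TensorProduct.map_smul_right, LinearMap.smul_comp,
      LinearMap.comp_smul])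
    (fun f g g' => by simp [conv, TensorProduct.map_add_left, LinearMap.add_comp,
      LinearMap.comp_add])
    (fun r f g => by simp [conv, TensorProduct.map_smul_left, LinearMap.smul_comp,
      LinearMap.comp_smul])

@[simp]
theorem convLin_apply [Coalgebra R C] (f g : C →ₗ[R] R) : convLin f g = conv f g := rfl

/-- The functional `c ↦ ∑ u c₍₁₎ c₍₂₎` attached to a bilinear form `u` on a coalgebra. -/
noncomputable def diagEval [Coalgebra R C] (u : C →ₗ[R] C →ₗ[R] R) : C →ₗ[R] R :=
  TensorProduct.lift u ∘ₗ Coalgebra.comul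

/-- The map `a ↦ ∑ g a₍₁₎ • u a₍₂₎`. -/
noncomputable def leftTwist [Coalgebra R C] {M : Type*} [AddCommGroup M] [Module R M]
    (g : C →ₗ[R] R) (u : C →ₗ[R] M) : C →ₗ[R] M :=
  (TensorProduct.lid R M).toLinearMap ∘ₗ TensorProduct.map g u ∘ₗ Coalgebra.comul

theorem conv_diagEval [Coalgebra R C] (g : C →ₗ[R] R) (u : C →ₗ[R] C →ₗ[R] R) :
    conv g (diagEval u) = diagEval (convLin g ∘ₗ u) := by
  have hl : conv g (diagEval u) = ((TensorProduct.lid R R).toLinearMap ∘ₗ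
      TensorProduct.map (TensorProduct.lift u) g) ∘ₗ
        LinearMap.rTensor C Coalgebra.comul ∘ₗ Coalgebra.comul := by
    rw [conv, diagEval, ← LinearMap.map_comp_rTensor]
    rfl
  have hr : TensorProduct.lift (convLin g ∘ₗ u) = ((TensorProduct.lid R R).toLinearMap ∘ₗ
      TensorProduct.map (TensorProduct.lift u) g) ∘ₗ
        (TensorProduct.assoc R C C C).symm.toLinearMap ∘ₗ LinearMap.lTensor C Coalgebra.comul := by
    ext a d
    simp only [conv, convLin_apply, TensorProduct.AlgebraTensorModule.curry_apply,
      LinearMap.restrictScalars_self, TensorProduct.curry_apply, TensorProduct.lift.tmul,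
      LinearMap.comp_apply, LinearMap.lTensor_tmul]
    induction (Coalgebra.comul d : C ⊗[R] C) with
    | zero => simp
    | add x y hx hy => simp only [map_add, hx, hy, TensorProduct.tmul_add]
    | tmul x y => simp
  rw [hl, diagEval, hr]
  ext c
  simp [← Coalgebra.coassoc_apply]

theorem conv_diagEval_left [Coalgebra R C] (g : C →ₗ[R] R) (u : C →ₗ[R] C →ₗ[R] R) :
    conv (diagEval u) g = diagEval (leftTwist g u) := by
  have hl : conv (diagEval u) g = ((TensorProduct.lid R R).toLinearMap ∘ₗ
      TensorProduct.map g (TensorProduct.lift u)) ∘ₗ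
        LinearMap.lTensor C Coalgebra.comul ∘ₗ Coalgebra.comul := by
    rw [conv, diagEval, ← LinearMap.map_comp_lTensor]
    rfl
  have hr : TensorProduct.lift (leftTwist g u) = ((TensorProduct.lid R R).toLinearMap ∘ₗ
      TensorProduct.map g (TensorProduct.lift u)) ∘ₗ
        (TensorProduct.assoc R C C C).toLinearMap ∘ₗ LinearMap.rTensor C Coalgebra.comul := by
    ext a d
    simp only [leftTwist, TensorProduct.AlgebraTensorModule.curry_apply,
      LinearMap.restrictScalars_self, TensorProduct.curry_apply, TensorProduct.lift.tmul,
      LinearMap.comp_apply, LinearMap.rTensor_tmul]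
    induction (Coalgebra.comul a : C ⊗[R] C) with
    | zero => simp
    | add x y hx hy => simp only [map_add, LinearMap.add_apply, hx, hy, TensorProduct.add_tmul]
    | tmul x y => simp
  rw [hl, diagEval, hr]
  ext c
  simp [Coalgebra.coassoc_apply]

theorem comp_leftTwist [Coalgebra R C] {M N : Type*} [AddCommGroup M] [Module R M]
    [AddCommGroup N] [Module R N] (g : C →ₗ[R] R) (u : C →ₗ[R] M) (φ : M →ₗ[R] N) :
    leftTwist g (φ ∘ₗ u) = φ ∘ₗ leftTwist g u := by
  ext a
  simp only [leftTwist, LinearMap.comp_apply]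
  induction (Coalgebra.comul a : C ⊗[R] C) with
  | zero => simp
  | add x y hx hy => simp only [map_add, hx, hy]
  | tmul x y => simp

theorem conv_eq_diagEval [Coalgebra R C] (f g : C →ₗ[R] R) :
    conv f g = diagEval (g.smulRight f) := by
  rw [conv, diagEval, ← LinearMap.comp_assoc]
  congr 1
  ext a d
  simp

theorem conv_assoc [Coalgebra R C] (f g h : C →ₗ[R] R) :
    conv (conv f g) h = conv f (conv g h) := by
  rw [conv_eq_diagEval g h, conv_diagEval, conv_eq_diagEval (conv f g) h]
  congr 1
  ext a d
  simp only [LinearMap.comp_apply, LinearMap.smulRight_apply, map_smul, convLin_apply]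

theorem conv_counit [Coalgebra R C] (f : C →ₗ[R] R) : conv f Coalgebra.counit = f := by
  ext c
  have h : TensorProduct.map (Coalgebra.counit (R := R) (A := C)) f =
      LinearMap.lTensor R f ∘ₗ LinearMap.rTensor C Coalgebra.counit := by
    rw [LinearMap.lTensor_comp_rTensor]
  rw [conv, LinearMap.comp_apply, LinearMap.comp_apply, h, LinearMap.comp_apply,
    Coalgebra.rTensor_counit_comul]
  simp

/-- If a bilinear form `u` is balanced, in the sense that `∑ g a₍₁₎ u(a₍₂₎, d) = ∑ u(a, d₍₁₎) g d₍₂₎`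
for all `g`, and `∑ u(c₍₁₎, c₍₂₎) = ε c`, then `f ↦ (c ↦ ∑ u(c₍₁₎, c₍₃₎) f c₍₂₎)` is a retraction
of the convolution algebra onto its center, linear over the center. -/
theorem exists_center_retraction_of_balanced [Coalgebra R C] (u : C →ₗ[R] C →ₗ[R] R)
    (hu : ∀ g, leftTwist g u = convLin g ∘ₗ u) (hε : diagEval u = Coalgebra.counit) :
    ∃ π : (C →ₗ[R] R) → (C →ₗ[R] R),
      (∀ f : C →ₗ[R] R, InConvCenter (π f)) ∧
      (∀ f : C →ₗ[R] R, InConvCenter f → π f = f) ∧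
      (∀ f₁ f₂ : C →ₗ[R] R, π (f₁ + f₂) = π f₁ + π f₂) ∧
      (∀ (z f : C →ₗ[R] R), InConvCenter z → π (conv z f) = conv z (π f)) := by
  refine ⟨fun f => diagEval (convLin.flip f ∘ₗ u), fun f g => ?_, fun f hf => ?_,
    fun f₁ f₂ => ?_, fun z f hz => ?_⟩
  · rw [conv_diagEval, conv_diagEval_left, comp_leftTwist, hu]
    congr 1
    ext a : 1
    simp [conv_assoc]
  · calc diagEval (convLin.flip f ∘ₗ u) = diagEval (convLin f ∘ₗ u) := by
          congr 1
          ext a : 1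
          simp [hf (u a)]
      _ = f := by rw [← conv_diagEval, hε, conv_counit]
  · ext c
    simp only [diagEval, map_add, LinearMap.add_comp, LinearMap.comp_apply, LinearMap.add_apply]
    induction (Coalgebra.comul c : C ⊗[R] C) with
    | zero => simp
    | add x y hx hy => simp only [map_add, hx, hy]; abel
    | tmul x y => simp
  · simp only [conv_diagEval]
    congr 1
    ext a : 1
    simp [← conv_assoc, hz (u a)]

theorem center_direct_summand_of_coseparable [Coalgebra R C]
    (ω : C ⊗[R] C →ₗ[R] C)
    (hω₁ : ω ∘ₗ (Coalgebra.comul : C →ₗ[R] C ⊗[R] C) = LinearMap.id)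
    (hω₂ : (LinearMap.lTensor C ω) ∘ₗ (TensorProduct.assoc R C C C).toLinearMap ∘ₗ
        (LinearMap.rTensor C (Coalgebra.comul : C →ₗ[R] C ⊗[R] C)) =
      (Coalgebra.comul : C →ₗ[R] C ⊗[R] C) ∘ₗ ω)
    (hω₃ : (LinearMap.rTensor C ω) ∘ₗ (TensorProduct.assoc R C C C).symm.toLinearMap ∘ₗ
        (LinearMap.lTensor C (Coalgebra.comul : C →ₗ[R] C ⊗[R] C)) =
      (Coalgebra.comul : C →ₗ[R] C ⊗[R] C) ∘ₗ ω) :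
    ∃ π : (C →ₗ[R] R) → (C →ₗ[R] R),
      (∀ f : C →ₗ[R] R, InConvCenter (π f)) ∧
      (∀ f : C →ₗ[R] R, InConvCenter f → π f = f) ∧
      (∀ f₁ f₂ : C →ₗ[R] R, π (f₁ + f₂) = π f₁ + π f₂) ∧
      (∀ (z f : C →ₗ[R] R), InConvCenter z → π (conv z f) = conv z (π f)) := by
  have hε₁ : ∀ t : C ⊗[R] C, ∀ g : C →ₗ[R] R,
      TensorProduct.lid R R (TensorProduct.map g Coalgebra.counit t) =
        g (TensorProduct.rid R C (LinearMap.lTensor C Coalgebra.counit t)) := fun t g => by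
    induction t with
    | zero => simp
    | add x y hx hy => simp only [map_add, hx, hy]
    | tmul x y => simp [mul_comm]
  have hε₂ : ∀ t : C ⊗[R] C, ∀ g : C →ₗ[R] R,
      TensorProduct.lid R R (TensorProduct.map Coalgebra.counit g t) =
        g (TensorProduct.lid R C (LinearMap.rTensor C Coalgebra.counit t)) := fun t g => by
    induction t with
    | zero => simp
    | add x y hx hy => simp only [map_add, hx, hy]
    | tmul x y => simp
  refine exists_center_retraction_of_balanced
    (TensorProduct.curry (Coalgebra.counit ∘ₗ ω)) (fun g => ?_) ?_
  · ext a d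
    trans g (ω (a ⊗ₜ d))
    · have h := hε₁ (Coalgebra.comul (ω (a ⊗ₜ d))) g
      rw [Coalgebra.lTensor_counit_comul,
        show Coalgebra.comul (ω (a ⊗ₜ d)) = _ from (LinearMap.congr_fun hω₂ (a ⊗ₜ[R] d)).symm] at h
      simp only [TensorProduct.rid_tmul, one_smul] at h
      rw [← h]
      simp only [leftTwist, LinearMap.comp_apply, LinearMap.rTensor_tmul]
      induction (Coalgebra.comul a : C ⊗[R] C) with
      | zero => simp
      | add x y hx hy => simp only [map_add, LinearMap.add_apply, hx, hy, TensorProduct.add_tmul]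
      | tmul x y => simp
    · have h := hε₂ (Coalgebra.comul (ω (a ⊗ₜ d))) g
      rw [Coalgebra.rTensor_counit_comul,
        show Coalgebra.comul (ω (a ⊗ₜ d)) = _ from (LinearMap.congr_fun hω₃ (a ⊗ₜ[R] d)).symm] at h
      simp only [TensorProduct.lid_tmul, one_smul] at h
      rw [← h]
      simp only [convLin_apply, conv, LinearMap.comp_apply, LinearMap.lTensor_tmul]
      induction (Coalgebra.comul d : C ⊗[R] C) with
      | zero => simp
      | add x y hx hy => simp only [map_add, hx, hy, TensorProduct.tmul_add]
      | tmul x y => simp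
  · have hc : TensorProduct.lift (TensorProduct.curry (Coalgebra.counit ∘ₗ ω)) =
        Coalgebra.counit (R := R) ∘ₗ ω := by
      ext
      simp
    rw [diagEval, hc, LinearMap.comp_assoc, hω₁, LinearMap.comp_id]
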